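/- Let φ : ℝ² → ℂ be continuous and let A₀ : ℝ² → ℝ be a twice continuously differentiable solution of ΔA₀ = |φ|² A₀ on all of ℝ² satisfying ∫_{ℝ²} |∇A₀|² dx < ∞. Then ∇A₀ vanishes identically on ℝ² and ∫_{ℝ²} |φ|² A₀² dx = 0; in particular φ(x) A₀(x) = 0 for every x ∈ ℝ². -/

import Mathlib

/-!
Consequences of the Julia–Zee proposition: the gradient of A₀ vanishes
identically, ∫ |φ|² A₀² = 0, and φ(x) A₀(x) = 0 pointwise.
-/

open MeasureTheory

noncomputable section

/-- The plane ℝ². -/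
abbrev Plane : Type := EuclideanSpace ℝ (Fin 2)

/-- Partial derivative in the `i`-th coordinate direction. -/
def pd (i : Fin 2) (f : Plane → ℝ) (x : Plane) : ℝ :=
  fderiv ℝ f x (EuclideanSpace.single i 1)

/-- The Laplacian on ℝ²: Δf = ∂₁²f + ∂₂²f. -/
def lap (f : Plane → ℝ) (x : Plane) : ℝ :=
  pd 0 (pd 0 f) x + pd 1 (pd 1 f) x

open Filter Topology Metric

lemma continuous_pd {f : Plane → ℝ} (hf : ContDiff ℝ 1 f) (i : Fin 2) : Continuous (pd i f) :=
  (hf.continuous_fderiv (by norm_num)).clm_apply continuous_const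

lemma contDiff_pd {f : Plane → ℝ} (hf : ContDiff ℝ 2 f) (i : Fin 2) : ContDiff ℝ 1 (pd i f) :=
  (hf.fderiv_right (m := 1) (by norm_num)).clm_apply contDiff_const

lemma hasCompactSupport_pd {f : Plane → ℝ} (hf : HasCompactSupport f) (i : Fin 2) :
    HasCompactSupport (pd i f) :=
  hf.fderiv_apply ℝ _

lemma gradient_apply (f : Plane → ℝ) (x : Plane) (i : Fin 2) : gradient f x i = pd i f x := by
  have h := inner_gradient_left (𝕜 := ℝ) (f := f) (x := x) (y := EuclideanSpace.single i (1 : ℝ))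
  rw [pd, ← h, EuclideanSpace.inner_single_right]
  simp

lemma norm_gradient_sq (f : Plane → ℝ) (x : Plane) :
    ‖gradient f x‖ ^ 2 = pd 0 f x ^ 2 + pd 1 f x ^ 2 := by
  simp [EuclideanSpace.real_norm_sq_eq, Fin.sum_univ_two, gradient_apply]

/-- Integration by parts against a compactly supported test function. -/
lemma integral_mul_pd_pd {g u : Plane → ℝ} (hg : ContDiff ℝ 1 g) (hgc : HasCompactSupport g)
    (hu : ContDiff ℝ 2 u) (i : Fin 2) :
    ∫ x, g x * pd i (pd i u) x = - ∫ x, pd i g x * pd i u x := by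
  have hv := contDiff_pd hu i
  refine integral_mul_fderiv_eq_neg_fderiv_mul_of_integrable ?_ ?_ ?_
    (fun x _ => hg.differentiable (by norm_num) x) (fun x _ => hv.differentiable (by norm_num) x)
  · exact ((continuous_pd hg i).mul hv.continuous).integrable_of_hasCompactSupport
      (hasCompactSupport_pd hgc i).mul_right
  · exact (hg.continuous.mul (continuous_pd hv i)).integrable_of_hasCompactSupport hgc.mul_right
  · exact (hg.continuous.mul hv.continuous).integrable_of_hasCompactSupport hgc.mul_right

/-- Green's first identity against a compactly supported test function. -/
lemma integral_mul_lap {g u : Plane → ℝ} (hg : ContDiff ℝ 1 g) (hgc : HasCompactSupport g)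
    (hu : ContDiff ℝ 2 u) :
    ∫ x, g x * lap u x = - ∫ x, (pd 0 g x * pd 0 u x + pd 1 g x * pd 1 u x) := by
  have hint (i : Fin 2) : Integrable (fun x => g x * pd i (pd i u) x) :=
    (hg.continuous.mul (continuous_pd (contDiff_pd hu i) i)).integrable_of_hasCompactSupport
      hgc.mul_right
  have hint' (i : Fin 2) : Integrable (fun x => pd i g x * pd i u x) :=
    ((continuous_pd hg i).mul (contDiff_pd hu i).continuous).integrable_of_hasCompactSupport
      (hasCompactSupport_pd hgc i).mul_right
  simp only [lap, mul_add]
  rw [integral_add (hint 0) (hint 1), integral_add (hint' 0) (hint' 1),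
    integral_mul_pd_pd hg hgc hu, integral_mul_pd_pd hg hgc hu, neg_add]

/-- Cutoff functions at every scale whose Dirichlet energy does not depend on the scale. -/
lemma exists_cutoff : ∃ K : ℝ, ∀ R : ℝ, 0 < R → ∃ η : Plane → ℝ,
    ContDiff ℝ 1 η ∧ HasCompactSupport η ∧ (∀ x, 0 ≤ η x) ∧ (∀ x, ‖x‖ ≤ R → η x = 1) ∧
    (∀ i x, ‖x‖ < R → pd i η x = 0) ∧ ∫ x, (pd 0 η x ^ 2 + pd 1 η x ^ 2) = K := by
  let b : ContDiffBump (0 : Plane) := ⟨1, 2, one_pos, one_lt_two⟩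
  refine ⟨∫ x, (pd 0 b x ^ 2 + pd 1 b x ^ 2), fun R hR => ⟨fun x => b (R⁻¹ • x), ?_⟩⟩
  have h_one (x : Plane) (hx : ‖x‖ ≤ R) : b (R⁻¹ • x) = 1 := by
    refine b.one_of_mem_closedBall ?_
    rw [mem_closedBall_zero_iff, norm_smul, norm_inv, Real.norm_of_nonneg hR.le]
    exact inv_mul_le_one_of_le₀ hx hR.le
  have hpd (i : Fin 2) (x : Plane) : pd i (fun x => b (R⁻¹ • x)) x = R⁻¹ * pd i b (R⁻¹ • x) := by
    simp only [pd]
    rw [fderiv_comp_smul]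
    simp
  refine ⟨b.contDiff.comp (contDiff_const_smul R⁻¹), ?_, fun x => b.nonneg, h_one, ?_, ?_⟩
  · exact b.hasCompactSupport.comp_smul (inv_ne_zero hR.ne')
  · intro i x hx
    have h : (fun x => b (R⁻¹ • x)) =ᶠ[𝓝 x] fun _ => 1 := by
      filter_upwards [isOpen_ball.mem_nhds (mem_ball_zero_iff.2 hx)] with y hy
      exact h_one y (mem_ball_zero_iff.1 hy).le
    simp [pd, h.fderiv_eq]
  · have h := Measure.integral_comp_inv_smul_of_nonneg volume
      (fun x : Plane => pd 0 b x ^ 2 + pd 1 b x ^ 2) hR.le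
    simp only [hpd, mul_pow, ← mul_add, integral_const_mul]
    rw [h, finrank_euclideanSpace_fin, smul_eq_mul, ← mul_assoc, ← mul_pow,
      inv_mul_cancel₀ hR.ne', one_pow, one_mul]

lemma tendsto_setIntegral_le_norm {f : Plane → ℝ} (hf : Integrable f) :
    Tendsto (fun n : ℕ => ∫ x in {x | (n : ℝ) ≤ ‖x‖}, f x) atTop (𝓝 0) := by
  have h := tendsto_setIntegral_of_antitone (μ := volume) (f := f)
    (s := fun n : ℕ => {x : Plane | (n : ℝ) ≤ ‖x‖})
    (fun n => (isClosed_le continuous_const continuous_norm).measurableSet)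
    (fun m n hmn x hx => le_trans (Nat.cast_le.2 hmn : (m : ℝ) ≤ n) hx) ⟨0, hf.integrableOn⟩
  have he : (⋂ n : ℕ, {x : Plane | (n : ℝ) ≤ ‖x‖}) = ∅ := by
    ext x
    obtain ⟨n, hn⟩ := exists_nat_gt ‖x‖
    simp only [Set.mem_iInter, Set.mem_ofPred_eq, Set.mem_empty_iff_false, iff_false, not_forall,
      not_le]
    exact ⟨n, hn⟩
  simpa [he] using h

lemma neg_mul_add_le {a p q r s δ : ℝ} (ha : |a| ≤ 2) (hδ : 0 < δ) :
    -(a * (p * r + q * s)) ≤ δ * (p ^ 2 + q ^ 2) + δ⁻¹ * (r ^ 2 + s ^ 2) := by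
  have key (p r : ℝ) : -(a * (p * r)) ≤ δ * p ^ 2 + δ⁻¹ * r ^ 2 := by
    have h₁ : -(a * (p * r)) ≤ 2 * |p * r| := by
      refine (neg_le_abs _).trans ?_
      rw [abs_mul]
      gcongr
    have h₂ : δ * p ^ 2 + δ⁻¹ * r ^ 2 - 2 * |p * r| = δ⁻¹ * (δ * |p| - |r|) ^ 2 := by
      rw [abs_mul, sub_sq, mul_pow, sq_abs, sq_abs]
      field_simp
      ring
    have h₃ : 0 ≤ δ⁻¹ * (δ * |p| - |r|) ^ 2 := by positivity
    linarith
  linarith [key p r, key q s]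

lemma abs_arctan_le_two (t : ℝ) : |Real.arctan t| ≤ 2 := by
  rw [abs_le]
  constructor <;> linarith [Real.neg_pi_div_two_lt_arctan t, Real.arctan_lt_pi_div_two t,
    Real.pi_lt_four]

lemma mul_arctan_nonneg (t : ℝ) : 0 ≤ t * Real.arctan t := by
  rcases le_total 0 t with h | h
  · exact mul_nonneg h (Real.arctan_nonneg.2 h)
  · exact mul_nonneg_of_nonpos_of_nonpos h (Real.arctan_le_zero.2 h)

lemma pd_mul_arctan {η u : Plane → ℝ} (hη : ContDiff ℝ 1 η) (hu : ContDiff ℝ 2 u) (i : Fin 2)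
    (x : Plane) : pd i (fun x => η x * Real.arctan (u x)) x =
      pd i η x * Real.arctan (u x) + η x * (pd i u x / (1 + u x ^ 2)) := by
  have h₁ := (hη.differentiable (by norm_num) x).hasFDerivAt
  have h₂ := (hu.differentiable (by norm_num) x).hasFDerivAt.arctan
  simp only [pd]
  rw [(h₁.fun_mul h₂).fderiv]
  simp
  ring

/-- Testing `Δu = V u` against `η arctan u`. -/
lemma integral_cutoff_mul_energy {V η u : Plane → ℝ} (hV : Continuous V) (hη : ContDiff ℝ 1 η)
    (hηc : HasCompactSupport η) (hu : ContDiff ℝ 2 u) (heq : ∀ x, lap u x = V x * u x) :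
    ∫ x, η x * (V x * (u x * Real.arctan (u x)) +
        (pd 0 u x ^ 2 + pd 1 u x ^ 2) / (1 + u x ^ 2)) =
      ∫ x, -(Real.arctan (u x) * (pd 0 η x * pd 0 u x + pd 1 η x * pd 1 u x)) := by
  have hu1 : ContDiff ℝ 1 u := hu.of_le (by norm_num)
  have hg : ContDiff ℝ 1 (fun x => η x * Real.arctan (u x)) := hη.mul hu1.arctan
  have h := integral_mul_lap hg hηc.mul_right hu
  simp only [heq, pd_mul_arctan hη hu] at h
  have hc := hu1.continuous
  have hcη := hη.continuous
  have hc0 := continuous_pd hu1 0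
  have hc1 := continuous_pd hu1 1
  have he0 := continuous_pd hη 0
  have he1 := continuous_pd hη 1
  have hne (x : Plane) : 1 + u x ^ 2 ≠ 0 := by positivity
  have ha : Continuous fun x => Real.arctan (u x) := Real.continuous_arctan.comp hc
  have i₁ : Integrable fun x => η x * (V x * (u x * Real.arctan (u x))) :=
    (by fun_prop : Continuous _).integrable_of_hasCompactSupport hηc.mul_right
  have i₂ : Integrable fun x => η x * ((pd 0 u x ^ 2 + pd 1 u x ^ 2) / (1 + u x ^ 2)) :=
    (hcη.mul (((hc0.pow 2).add (hc1.pow 2)).div (by fun_prop) hne)).integrable_of_hasCompactSupport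
      hηc.mul_right
  have i₃ : Integrable fun x =>
      Real.arctan (u x) * (pd 0 η x * pd 0 u x + pd 1 η x * pd 1 u x) :=
    (by fun_prop : Continuous _).integrable_of_hasCompactSupport
      (((hasCompactSupport_pd hηc 0).mul_right.add (hasCompactSupport_pd hηc 1).mul_right).mul_left)
  have e₁ : ∫ x, η x * Real.arctan (u x) * (V x * u x) =
      ∫ x, η x * (V x * (u x * Real.arctan (u x))) := by
    congr 1 with x
    ring
  have e₂ : ∫ x, ((pd 0 η x * Real.arctan (u x) + η x * (pd 0 u x / (1 + u x ^ 2))) * pd 0 u x +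
      (pd 1 η x * Real.arctan (u x) + η x * (pd 1 u x / (1 + u x ^ 2))) * pd 1 u x) =
      (∫ x, η x * ((pd 0 u x ^ 2 + pd 1 u x ^ 2) / (1 + u x ^ 2))) +
      ∫ x, Real.arctan (u x) * (pd 0 η x * pd 0 u x + pd 1 η x * pd 1 u x) := by
    rw [← integral_add i₂ i₃]
    congr 1 with x
    ring
  simp only [mul_add (η _)]
  rw [integral_add i₁ i₂, integral_neg, ← e₁, h, e₂]
  ring

lemma energy_density_eq_zero {V u : Plane → ℝ} (hV : Continuous V) (hV0 : ∀ x, 0 ≤ V x)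
    (hu : ContDiff ℝ 2 u) (heq : ∀ x, lap u x = V x * u x)
    (hfin : Integrable fun x => pd 0 u x ^ 2 + pd 1 u x ^ 2) (x₀ : Plane) :
    V x₀ * (u x₀ * Real.arctan (u x₀)) +
      (pd 0 u x₀ ^ 2 + pd 1 u x₀ ^ 2) / (1 + u x₀ ^ 2) = 0 := by
  let h : Plane → ℝ := fun x => V x * (u x * Real.arctan (u x)) +
    (pd 0 u x ^ 2 + pd 1 u x ^ 2) / (1 + u x ^ 2)
  change h x₀ = 0
  have hu1 : ContDiff ℝ 1 u := hu.of_le (by norm_num)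
  have hc := hu1.continuous
  have hc0 := continuous_pd hu1 0
  have hc1 := continuous_pd hu1 1
  have ha : Continuous fun x => Real.arctan (u x) := Real.continuous_arctan.comp hc
  have hcont : Continuous h :=
    (by fun_prop : Continuous fun x => V x * (u x * Real.arctan (u x))).add
      (((hc0.pow 2).add (hc1.pow 2)).div (by fun_prop) fun x => by positivity)
  have hnn (x : Plane) : 0 ≤ h x :=
    add_nonneg (mul_nonneg (hV0 x) (mul_arctan_nonneg _)) (by positivity)
  by_contra hne
  let χ : ContDiffBump x₀ := ⟨1, 2, one_pos, one_lt_two⟩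
  have hχ : 0 < ∫ x, χ x * h x :=
    (χ.continuous.mul hcont).integral_pos_of_hasCompactSupport_nonneg_nonzero
      χ.hasCompactSupport.mul_right (fun x => mul_nonneg χ.nonneg (hnn x)) (x := x₀)
      (mul_ne_zero (χ.pos_of_mem_ball (mem_ball_self χ.rOut_pos)).ne' hne)
  obtain ⟨K, hK⟩ := exists_cutoff
  have hbound (δ : ℝ) (hδ : 0 < δ) : ∫ x, χ x * h x ≤ δ * K := by
    have hlim : Tendsto (fun n : ℕ => δ * K + δ⁻¹ *
        ∫ x in {x : Plane | (n : ℝ) ≤ ‖x‖}, (pd 0 u x ^ 2 + pd 1 u x ^ 2)) atTop (𝓝 (δ * K)) := by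
      simpa using ((tendsto_setIntegral_le_norm hfin).const_mul δ⁻¹).const_add (δ * K)
    refine ge_of_tendsto hlim ?_
    filter_upwards [tendsto_natCast_atTop_atTop.eventually_ge_atTop (‖x₀‖ + 2)] with n hn
    obtain ⟨η, hη, hηc, hη0, hη1, hηd, hηK⟩ := hK n (by linarith [norm_nonneg x₀])
    have hmeas : MeasurableSet {x : Plane | (n : ℝ) ≤ ‖x‖} :=
      (isClosed_le continuous_const continuous_norm).measurableSet
    have he0 := continuous_pd hη 0
    have he1 := continuous_pd hη 1
    have hs0 := hasCompactSupport_pd hηc 0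
    have hs1 := hasCompactSupport_pd hηc 1
    have hiη : Integrable fun x => pd 0 η x ^ 2 + pd 1 η x ^ 2 := by
      simp only [sq]
      exact (by fun_prop : Continuous _).integrable_of_hasCompactSupport
        (hs0.mul_right.add hs1.mul_right)
    calc ∫ x, χ x * h x ≤ ∫ x, η x * h x := by
          refine integral_mono
            ((χ.continuous.mul hcont).integrable_of_hasCompactSupport χ.hasCompactSupport.mul_right)
            ((hη.continuous.mul hcont).integrable_of_hasCompactSupport hηc.mul_right) fun x => ?_
          refine mul_le_mul_of_nonneg_right ?_ (hnn x)
          rcases le_or_gt 2 (dist x x₀) with hx | hx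
          · rw [χ.zero_of_le_dist hx]
            exact hη0 x
          · rw [hη1 x]
            · exact χ.le_one
            · rw [dist_eq_norm] at hx
              linarith [norm_le_norm_add_norm_sub' x x₀]
      _ = ∫ x, -(Real.arctan (u x) * (pd 0 η x * pd 0 u x + pd 1 η x * pd 1 u x)) :=
          integral_cutoff_mul_energy hV hη hηc hu heq
      _ ≤ ∫ x, (δ * (pd 0 η x ^ 2 + pd 1 η x ^ 2) + δ⁻¹ *
            {x : Plane | (n : ℝ) ≤ ‖x‖}.indicator (fun x => pd 0 u x ^ 2 + pd 1 u x ^ 2) x) := by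
          refine integral_mono ?_ ((hiη.const_mul δ).add ((hfin.indicator hmeas).const_mul δ⁻¹))
            fun x => ?_
          · exact (by fun_prop : Continuous _).integrable_of_hasCompactSupport
              (hs0.mul_right.add hs1.mul_right).mul_left.neg
          · by_cases hx : (n : ℝ) ≤ ‖x‖
            · simpa [Set.indicator_of_mem (s := {x : Plane | (n : ℝ) ≤ ‖x‖}) hx] using
                neg_mul_add_le (abs_arctan_le_two (u x)) hδ
            · simp [Set.indicator, hx, hηd _ x (not_le.1 hx)]
      _ = _ := by
          rw [integral_add (hiη.const_mul δ) ((hfin.indicator hmeas).const_mul δ⁻¹),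
            integral_const_mul, integral_const_mul, hηK, integral_indicator hmeas]
  have hK0 : Tendsto (fun δ : ℝ => δ * K) (𝓝[>] 0) (𝓝 0) := by
    have : Tendsto (fun δ : ℝ => δ * K) (𝓝 0) (𝓝 (0 * K)) := tendsto_id.mul_const K
    rw [zero_mul] at this
    exact this.mono_left nhdsWithin_le_nhds
  have := ge_of_tendsto hK0 (eventually_mem_nhdsWithin.mono hbound)
  linarith

theorem julia_zee_gradient_and_charge (φ : Plane → ℂ) (A₀ : Plane → ℝ)
    (hφ : Continuous φ) (hA₀ : ContDiff ℝ 2 A₀)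
    (heq : ∀ x, lap A₀ x = ‖φ x‖ ^ 2 * A₀ x)
    (hfin : Integrable (fun x => ‖gradient A₀ x‖ ^ 2)) :
    (∀ x, gradient A₀ x = 0) ∧
    (∫ x, ‖φ x‖ ^ 2 * (A₀ x) ^ 2) = 0 ∧
    (∀ x, φ x * (A₀ x : ℂ) = 0) := by
  simp only [norm_gradient_sq] at hfin
  have hV : Continuous fun x => ‖φ x‖ ^ 2 := by fun_prop
  have hzero := energy_density_eq_zero hV (fun x => sq_nonneg _) hA₀ heq hfin
  have hsplit (x : Plane) : ‖φ x‖ ^ 2 * (A₀ x * Real.arctan (A₀ x)) = 0 ∧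
      (pd 0 A₀ x ^ 2 + pd 1 A₀ x ^ 2) / (1 + A₀ x ^ 2) = 0 :=
    (add_eq_zero_iff_of_nonneg (mul_nonneg (sq_nonneg _) (mul_arctan_nonneg _))
      (by positivity)).1 (hzero x)
  have hcharge (x : Plane) : φ x = 0 ∨ A₀ x = 0 := by
    simpa using (hsplit x).1
  refine ⟨fun x => ?_, ?_, fun x => ?_⟩
  · have hne : 1 + A₀ x ^ 2 ≠ 0 := by positivity
    rw [← norm_eq_zero, ← sq_eq_zero_iff, norm_gradient_sq]
    exact (div_eq_zero_iff.1 (hsplit x).2).resolve_right hne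
  · have h (x : Plane) : ‖φ x‖ ^ 2 * A₀ x ^ 2 = 0 := by
      rcases hcharge x with h | h <;> simp [h]
    simp [h]
  · simpa using hcharge x

end
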